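/- Let m, d be positive natural numbers and for each site s ∈ ℕ and index i ∈ {1, …, d} let A_i^[s] be an m × m complex matrix satisfying the consistency condition: for every n and every i ∈ {1, …, d}, ∑_{j=1}^{d} (A_j^[n+1])† (A_i^[n])† ⊗ A_i^[n] A_j^[n+1] = (A_i^[n])† ⊗ A_i^[n]. Then for every n ≥ 1, every k ≥ 0, and all indices i_1, …, i_n, j_1, …, j_n ∈ {1, …, d}: ∑_{i_{n+1}, …, i_{n+k+1}} conj(Tr(A_{i_1}^[1] ⋯ A_{i_n}^[n] A_{i_{n+1}}^[n+1] ⋯ A_{i_{n+k+1}}^[n+k+1])) · Tr(A_{j_1}^[1] ⋯ A_{j_n}^[n] A_{i_{n+1}}^[n+1] ⋯ A_{i_{n+k+1}}^[n+k+1]) = ∑_{ℓ=1}^{d} conj(Tr(A_{i_1}^[1] ⋯ A_{i_n}^[n] A_ℓ^[n+1])) · Tr(A_{j_1}^[1] ⋯ A_{j_n}^[n] A_ℓ^[n+1]). In particular the sequence of states φ_n determined by these correlation coefficients is projective: φ_{n+k} restricted to observables on the first n sites coincides with φ_n. -/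

import Mathlib

open Matrix Kronecker

theorem mps_key {m d : ℕ} (A : ℕ → Fin d → Matrix (Fin m) (Fin m) ℂ)
    (hcons : ∀ n : ℕ, ∀ i : Fin d,
      ∑ j : Fin d, ((A (n + 1) j)ᴴ * (A n i)ᴴ) ⊗ₖ (A n i * A (n + 1) j)
        = (A n i)ᴴ ⊗ₖ (A n i))
    (s : ℕ) (l : Fin d) (P Q : Matrix (Fin m) (Fin m) ℂ) :
    ∑ a : Fin d, (starRingEnd ℂ) (Matrix.trace (P * A s l * A (s + 1) a)) *
        Matrix.trace (Q * A s l * A (s + 1) a)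
      = (starRingEnd ℂ) (Matrix.trace (P * A s l)) * Matrix.trace (Q * A s l) := by
  have aux : ∀ X : Matrix (Fin m) (Fin m) ℂ,
      (starRingEnd ℂ) (Matrix.trace (P * X)) * Matrix.trace (Q * X)
        = Matrix.trace ((Xᴴ ⊗ₖ X) * (Pᴴ ⊗ₖ Q)) := by
    intro X
    rw [← Matrix.mul_kronecker_mul, Matrix.trace_kronecker, ← Matrix.conjTranspose_mul,
      Matrix.trace_conjTranspose, Matrix.trace_mul_comm X Q]
    rfl
  simp only [Matrix.mul_assoc]
  simp only [aux]
  rw [← hcons s l, Finset.sum_mul, Matrix.trace_sum]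
  simp only [Matrix.conjTranspose_mul]

theorem mps_tail {m d : ℕ} (A : ℕ → Fin d → Matrix (Fin m) (Fin m) ℂ)
    (hcons : ∀ n : ℕ, ∀ i : Fin d,
      ∑ j : Fin d, ((A (n + 1) j)ᴴ * (A n i)ᴴ) ⊗ₖ (A n i * A (n + 1) j)
        = (A n i)ᴴ ⊗ₖ (A n i))
    (k : ℕ) : ∀ (s : ℕ) (l : Fin d) (P Q : Matrix (Fin m) (Fin m) ℂ),
    ∑ e : Fin k → Fin d,
        (starRingEnd ℂ) (Matrix.trace (P * A s l *
          (List.ofFn fun t : Fin k => A (s + 1 + t.val) (e t)).prod)) *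
        Matrix.trace (Q * A s l *
          (List.ofFn fun t : Fin k => A (s + 1 + t.val) (e t)).prod)
      = (starRingEnd ℂ) (Matrix.trace (P * A s l)) * Matrix.trace (Q * A s l) := by
  induction k with
  | zero => intro s l P Q; simp
  | succ k ih =>
    intro s l P Q
    rw [← (Fin.consEquiv fun _ => Fin d).sum_comp, Fintype.sum_prod_type,
      ← mps_key A hcons s l P Q]
    refine Finset.sum_congr rfl fun a _ => ?_
    rw [← ih (s + 1) a (P * A s l) (Q * A s l)]
    refine Finset.sum_congr rfl fun e _ => ?_
    have h : ∀ t : Fin k, s + 1 + (t.val + 1) = s + 1 + 1 + t.val := fun t => by omega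
    simp only [Fin.consEquiv, List.ofFn_succ (n := k), List.prod_cons, Matrix.mul_assoc, h,
      Equiv.coe_fn_mk, Fin.cons_zero, Fin.cons_succ, Fin.val_succ, Fin.val_zero, add_zero]

/-- under the consistency condition, the correlation coefficients obtained by
summing out the sites `n+1, …, n+k+1` collapse to a single sum over the site `n+1`; this is
the projectivity of the sequence of states `φ_n`.  Site `s` of the chain (with
`s = 1, 2, …`) carries the matrices `A s i`. -/
theorem mps_projectivity
    (m d : ℕ) (hm : 0 < m) (hd : 0 < d)
    (A : ℕ → Fin d → Matrix (Fin m) (Fin m) ℂ)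
    (hcons : ∀ n : ℕ, ∀ i : Fin d,
      ∑ j : Fin d, ((A (n + 1) j)ᴴ * (A n i)ᴴ) ⊗ₖ (A n i * A (n + 1) j)
        = (A n i)ᴴ ⊗ₖ (A n i))
    (n k : ℕ) (hn : 1 ≤ n)
    (i j : Fin n → Fin d) :
    ∑ e : Fin (k + 1) → Fin d,
        (starRingEnd ℂ) (Matrix.trace
            ((List.ofFn fun t : Fin n => A (t.val + 1) (i t)).prod *
              (List.ofFn fun t : Fin (k + 1) => A (n + 1 + t.val) (e t)).prod)) *
          Matrix.trace
            ((List.ofFn fun t : Fin n => A (t.val + 1) (j t)).prod *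
              (List.ofFn fun t : Fin (k + 1) => A (n + 1 + t.val) (e t)).prod)
      = ∑ l : Fin d,
        (starRingEnd ℂ) (Matrix.trace
            ((List.ofFn fun t : Fin n => A (t.val + 1) (i t)).prod * A (n + 1) l)) *
          Matrix.trace
            ((List.ofFn fun t : Fin n => A (t.val + 1) (j t)).prod * A (n + 1) l) := by
  rw [← (Fin.consEquiv fun _ => Fin d).sum_comp, Fintype.sum_prod_type]
  refine Finset.sum_congr rfl fun a _ => ?_
  rw [← mps_tail A hcons k (n + 1) a]
  refine Finset.sum_congr rfl fun e _ => ?_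
  have h : ∀ t : Fin k, n + 1 + (t.val + 1) = n + 1 + 1 + t.val := fun t => by omega
  simp only [Fin.consEquiv, List.ofFn_succ (n := k), List.prod_cons, Matrix.mul_assoc, h,
    Equiv.coe_fn_mk, Fin.cons_zero, Fin.cons_succ, Fin.val_succ, Fin.val_zero, add_zero]
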